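/- Fix k ≥ 1. For every v = (v₁,…,v_k) ∈ ℂ^k, p ∈ ℂ, e ∈ ℂ×, and b, g ∈ ℂ^{k−1}, one has the matrix identity x₋(v)·y(p,e,b,g) = y(p − v_k e, e, b, (g₁ − v₁, …, g_{k−1} − v_{k−1})). In particular the set of matrices {y(p,e,b,g) : p ∈ ℂ, e ∈ ℂ×, b, g ∈ ℂ^{k−1}} is stable under left multiplication by x₋(v), this left multiplication leaves e and b unchanged and translates the coordinates g_i and p (so it realizes the translation action of the additive group 𝔾_a^k on the open Zastava coordinates), and the action is free: if x₋(v)·y(p,e,b,g) = y(p,e,b,g) then v = 0. -/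

import Mathlib

open Matrix

noncomputable section

/-- `K = ℂ((t⁻¹))`, the field of formal Laurent series in `t⁻¹`.  We realize it as
`LaurentSeries ℂ`, where the Laurent-series variable `X` plays the role of `t⁻¹`;
thus for `f : K`, `f.coeff j` is the coefficient of `t^{-j}`. -/
abbrev K : Type := LaurentSeries ℂ

/-- The element `t` (the inverse of the Laurent series variable). -/
def tK : K := (HahnSeries.single (-1 : ℤ) (1 : ℂ))

/-- The constant embedding `ℂ → K`. -/
def Cc (z : ℂ) : K := HahnSeries.C z

/-- `f ∈ 𝒪 = ℂ[[t⁻¹]]` : no positive powers of `t`. -/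
def memO (f : K) : Prop := ∀ j : ℤ, j < 0 → f.coeff j = 0

/-- `f ∈ 𝒪₁ = t⁻¹ℂ[[t⁻¹]]`. -/
def memO1 (f : K) : Prop := ∀ j : ℤ, j ≤ 0 → f.coeff j = 0

/-- `f ∈ ℂ[t]`. -/
def memPoly (f : K) : Prop := ∀ j : ℤ, 0 < j → f.coeff j = 0

/-- Upper unitriangular matrix. -/
def IsUpperUni {R : Type*} [Zero R] [One R] {m : ℕ} (M : Matrix (Fin m) (Fin m) R) : Prop :=
  (∀ i, M i i = 1) ∧ ∀ i j : Fin m, j < i → M i j = 0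

/-- Lower unitriangular matrix. -/
def IsLowerUni {R : Type*} [Zero R] [One R] {m : ℕ} (M : Matrix (Fin m) (Fin m) R) : Prop :=
  (∀ i, M i i = 1) ∧ ∀ i j : Fin m, i < j → M i j = 0

/-- `M ∈ N₁[[t⁻¹]]` : upper unitriangular with off-diagonal entries in `𝒪₁`. -/
def MemN1 {m : ℕ} (M : Matrix (Fin m) (Fin m) K) : Prop :=
  IsUpperUni M ∧ ∀ i j : Fin m, i ≠ j → memO1 (M i j)

/-- `M ∈ N₋,₁[[t⁻¹]]`. -/
def MemN1neg {m : ℕ} (M : Matrix (Fin m) (Fin m) K) : Prop :=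
  IsLowerUni M ∧ ∀ i j : Fin m, i ≠ j → memO1 (M i j)

/-- `M ∈ T₁[[t⁻¹]]` : diagonal with entries in `1 + 𝒪₁`. -/
def MemT1 {m : ℕ} (M : Matrix (Fin m) (Fin m) K) : Prop :=
  (∀ i j : Fin m, i ≠ j → M i j = 0) ∧ ∀ i, memO1 (M i i - 1)

/-- `M ∈ N[t]` : upper unitriangular with entries in `ℂ[t]`. -/
def MemNpoly {m : ℕ} (M : Matrix (Fin m) (Fin m) K) : Prop :=
  IsUpperUni M ∧ ∀ i j : Fin m, memPoly (M i j)

/-- `M ∈ N₋[t]` : lower unitriangular with entries in `ℂ[t]`. -/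
def MemNnegPoly {m : ℕ} (M : Matrix (Fin m) (Fin m) K) : Prop :=
  IsLowerUni M ∧ ∀ i j : Fin m, memPoly (M i j)

/-- `t^ν = diag(t^{ν₁},…,t^{ν_m})`. -/
def tPow {m : ℕ} (ν : Fin m → ℤ) : Matrix (Fin m) (Fin m) K :=
  Matrix.diagonal fun i => tK ^ ν i

/-- `y = u · h · t^ν · l` is a Gauss factorization exhibiting membership in `Gr_ν`. -/
def IsGauss {m : ℕ} (ν : Fin m → ℤ) (y u h l : Matrix (Fin m) (Fin m) K) : Prop :=
  MemN1 u ∧ MemT1 h ∧ MemN1neg l ∧ y = u * h * tPow ν * l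

/-- The matrix slice `Gr_ν = N₁[[t⁻¹]]·T₁[[t⁻¹]]·t^ν·N₋,₁[[t⁻¹]]`. -/
def GrSlice {m : ℕ} (ν : Fin m → ℤ) : Set (Matrix (Fin m) (Fin m) K) :=
  { y | ∃ u h l, IsGauss ν y u h l }

/-- Block embedding `τ_α : Mat_{k+1} → Mat_n` into (1-indexed) rows and columns `r₁,…,r₁+k`,
identity outside this block. -/
def blockEmbed {R : Type*} [Zero R] [One R] (n r₁ k : ℕ)
    (g : Matrix (Fin (k+1)) (Fin (k+1)) R) : Matrix (Fin n) (Fin n) R :=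
  fun i j =>
    if h : r₁ - 1 ≤ (i : ℕ) ∧ (i : ℕ) ≤ r₁ - 1 + k ∧ r₁ - 1 ≤ (j : ℕ) ∧ (j : ℕ) ≤ r₁ - 1 + k then
      g ⟨(i : ℕ) - (r₁ - 1), by omega⟩ ⟨(j : ℕ) - (r₁ - 1), by omega⟩
    else if i = j then 1 else 0

/-- The coweight `α` of `PGL_n` : `α_{r₁} = 1`, `α_{r₂+1} = -1` (1-indexed), all other
entries `0`. -/
def alphaCo (n r₁ r₂ : ℕ) : Fin n → ℤ :=
  fun i => if (i : ℕ) = r₁ - 1 then 1 else if (i : ℕ) = r₂ then -1 else 0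

/-- The matrix `y(p,e,b,g)` (matrix representative of a point of the open Zastava
`Gr⁰_{-α}`), a `(k+1)×(k+1)` matrix over `ℂ[t] ⊆ K`. -/
def ymat (k : ℕ) (p e : ℂ) (b g : Fin (k-1) → ℂ) :
    Matrix (Fin (k+1)) (Fin (k+1)) K :=
  fun i j =>
    if _hi0 : (i : ℕ) = 0 then
      (if _hjk : (j : ℕ) = k then Cc e else 0)
    else if _hik : (i : ℕ) = k then
      (if _hj0 : (j : ℕ) = 0 then Cc (-e⁻¹)
       else if _hjk : (j : ℕ) = k then tK - Cc (p + ∑ l : Fin (k-1), b l * g l)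
       else Cc (-(g ⟨k - (j : ℕ) - 1, by have := j.isLt; omega⟩)))
    else
      (if _hji : (j : ℕ) = (i : ℕ) then 1
       else if _hjk : (j : ℕ) = k then Cc (b ⟨k - (i : ℕ) - 1, by have := i.isLt; omega⟩)
       else 0)

/-- The matrix `x₋(v)` over `K` : identity except for the bottom row `(v_k,…,v₁,1)`. -/
def xminusK (k : ℕ) (v : Fin k → ℂ) : Matrix (Fin (k+1)) (Fin (k+1)) K :=
  fun i j =>
    if _hik : (i : ℕ) = k then
      (if _hjk : (j : ℕ) = k then 1 else Cc (v ⟨k - (j : ℕ) - 1, by have := j.isLt; omega⟩))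
    else if i = j then 1 else 0

/-- `Φ_α(y)` read off from the `N₁[[t⁻¹]]`-factor `u` of a Gauss factorization of `y`. -/
def PhiOf (n r₂ k : ℕ) (hrn : r₂ < n) (u : Matrix (Fin n) (Fin n) K) : Fin k → ℂ :=
  fun a => (u ⟨r₂ - 1 - (a : ℕ), by omega⟩ ⟨r₂, hrn⟩).coeff 1

/-- `ζ_α(y)` read off from the `N₁[[t⁻¹]]`-factor `u` of a Gauss factorization of `y`. -/
def ZetaOf (n r₁ r₂ k : ℕ) (hr1 : 1 ≤ r₁) (hrr : r₁ ≤ r₂) (hrn : r₂ < n)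
    (hk : k = r₂ - r₁ + 1) (u : Matrix (Fin n) (Fin n) K) : Fin k → ℂ :=
  fun a =>
    if _ha : (a : ℕ) = k - 1 then (u ⟨r₁ - 1, by omega⟩ ⟨r₂, hrn⟩).coeff 2
    else (u ⟨r₁ - 1, by omega⟩ ⟨r₁ + (a : ℕ), by have := a.isLt; omega⟩).coeff 1

/-- `ξ_α(y)`, computed from the `N₁[[t⁻¹]]`-factor `u` of a Gauss factorization of `y`. -/
def xiOf (n r₁ r₂ k : ℕ) (hr1 : 1 ≤ r₁) (hrr : r₁ ≤ r₂) (hrn : r₂ < n)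
    (hk : k = r₂ - r₁ + 1) (u : Matrix (Fin n) (Fin n) K) : Matrix (Fin n) (Fin n) K :=
  let c := PhiOf n r₂ k hrn u
  let z := ZetaOf n r₁ r₂ k hr1 hrr hrn hk u
  let e : ℂ := c ⟨k - 1, by omega⟩
  let b : Fin (k-1) → ℂ := fun i => c ⟨(i : ℕ), by have := i.isLt; omega⟩
  let g : Fin (k-1) → ℂ := fun i => z ⟨k - (i : ℕ) - 2, by omega⟩ / e
  let p : ℂ := z ⟨k - 1, by omega⟩ / e - ∑ i : Fin (k-1), b i * g i
  blockEmbed n r₁ k (ymat k p e b g)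

/-- `M` has identity submatrix in (1-indexed) rows and columns `r₁,…,r₁+k`. -/
def HasIdBlock {R : Type*} [Zero R] [One R] {n : ℕ} (r₁ k : ℕ)
    (M : Matrix (Fin n) (Fin n) R) : Prop :=
  ∀ i j : Fin n, r₁ - 1 ≤ (i : ℕ) → (i : ℕ) ≤ r₁ - 1 + k →
    r₁ - 1 ≤ (j : ℕ) → (j : ℕ) ≤ r₁ - 1 + k →
    M i j = if i = j then 1 else 0

/-- `M ∈ N^α(K)` : upper unitriangular over `K` with identity `(k+1)×(k+1)`-block. -/
def MemNalphaK (n r₁ k : ℕ) (M : Matrix (Fin n) (Fin n) K) : Prop :=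
  IsUpperUni M ∧ HasIdBlock r₁ k M

/-- `M ∈ N^α[t]`. -/
def MemNalphaPoly (n r₁ k : ℕ) (M : Matrix (Fin n) (Fin n) K) : Prop :=
  MemNalphaK n r₁ k M ∧ ∀ i j : Fin n, memPoly (M i j)

/-- `M ∈ N(K)^α₁ = x_α(N_{1,k+1}[[t⁻¹]])·N^α(K)`. -/
def MemNKalpha1 (n r₁ k : ℕ) (M : Matrix (Fin n) (Fin n) K) : Prop :=
  ∃ (a : Matrix (Fin (k+1)) (Fin (k+1)) K) (u : Matrix (Fin n) (Fin n) K),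
    MemN1 a ∧ MemNalphaK n r₁ k u ∧ M = blockEmbed n r₁ k a * u

/-- `z = π(x)` for the slice `Gr_ν` : `z ∈ Gr_ν` and `z = a·x·b` with `a ∈ N[t]`,
`b ∈ N₋[t]`. -/
def IsPiOf {n : ℕ} (ν : Fin n → ℤ) (x z : Matrix (Fin n) (Fin n) K) : Prop :=
  z ∈ GrSlice ν ∧ ∃ a b, MemNpoly a ∧ MemNnegPoly b ∧ z = a * x * b

/-- The open Zastava slice `Gr⁰_{-α} ⊆ GL_n(K)` : matrices `τ_α(y(p,e,b,g))`. -/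
def GrZeroNegAlpha (n r₁ k : ℕ) : Set (Matrix (Fin n) (Fin n) K) :=
  { M | ∃ (p e : ℂ) (b g : Fin (k-1) → ℂ), e ≠ 0 ∧ M = blockEmbed n r₁ k (ymat k p e b g) }

/-- `μ + α`. -/
def addAlpha (n r₁ r₂ : ℕ) (μ : Fin n → ℤ) : Fin n → ℤ :=
  fun i => μ i + alphaCo n r₁ r₂ i


@[simp] lemma Cc_zero : Cc 0 = 0 := map_zero HahnSeries.C

lemma Cc_add (x y : ℂ) : Cc (x + y) = Cc x + Cc y := map_add HahnSeries.C x y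

lemma Cc_sub (x y : ℂ) : Cc (x - y) = Cc x - Cc y := map_sub HahnSeries.C x y

lemma Cc_neg (x : ℂ) : Cc (-x) = -Cc x := map_neg HahnSeries.C x

lemma Cc_mul (x y : ℂ) : Cc (x * y) = Cc x * Cc y := map_mul HahnSeries.C x y

lemma Cc_sum {ι : Type*} (s : Finset ι) (f : ι → ℂ) : Cc (∑ i ∈ s, f i) = ∑ i ∈ s, Cc (f i) :=
  map_sum HahnSeries.C f s

lemma Cc_injective : Function.Injective Cc := HahnSeries.C_injective

/-- Rows of `x₋(v) * A` other than the last are those of `A`. -/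
lemma xminusK_mul_apply_of_ne {k : ℕ} (v : Fin k → ℂ) (A : Matrix (Fin (k+1)) (Fin (k+1)) K)
    {i : Fin (k+1)} (hi : (i : ℕ) ≠ k) (j : Fin (k+1)) : (xminusK k v * A) i j = A i j := by
  simp [Matrix.mul_apply, xminusK, hi]

/-- The last row of `x₋(v) * A`. -/
lemma xminusK_mul_apply_last {k : ℕ} (v : Fin k → ℂ) (A : Matrix (Fin (k+1)) (Fin (k+1)) K)
    (j : Fin (k+1)) :
    (xminusK k v * A) (Fin.last k) j =
      ∑ i : Fin k, Cc (v i) * A i.rev.castSucc j + A (Fin.last k) j := by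
  rw [Matrix.mul_apply, Fin.sum_univ_castSucc, ← Equiv.sum_comp Fin.revPerm]
  congr 1
  · refine Finset.sum_congr rfl fun i _ => ?_
    have hi : k - (k - ((i : ℕ) + 1)) - 1 = i := by omega
    have hne : k - ((i : ℕ) + 1) ≠ k := by omega
    simp [xminusK, Fin.val_rev, hi, hne]
  · simp [xminusK]

lemma ymat_last_last (m : ℕ) (p e : ℂ) (b g : Fin m → ℂ) :
    ymat (m+1) p e b g (Fin.last _) (Fin.last _) = tK - Cc (p + ∑ l : Fin m, b l * g l) := by
  simp only [ymat, Fin.val_last, Nat.add_one_ne_zero, dite_true, dite_false]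
  rfl

/-- Left multiplication by `x₋(v)` translates `p` and `g`, and fixes `e` and `b`. -/
lemma xminusK_mul_ymat (m : ℕ) (v : Fin (m+1) → ℂ) (p e : ℂ) (b g : Fin m → ℂ) :
    xminusK (m+1) v * ymat (m+1) p e b g =
      ymat (m+1) (p - v (Fin.last m) * e) e b (fun i => g i - v i.castSucc) := by
  ext1 i j
  by_cases hi : (i : ℕ) = m + 1
  · obtain rfl : i = Fin.last (m+1) := Fin.ext hi
    rw [xminusK_mul_apply_last, Fin.sum_univ_castSucc]
    have hmid (x : Fin m) : ymat (m+1) p e b g x.castSucc.rev.castSucc j =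
        if (j : ℕ) = m - x then 1 else if (j : ℕ) = m + 1 then Cc (b x) else 0 := by
      have h0 : m - (x : ℕ) ≠ 0 := by omega
      have h1 : m - (x : ℕ) ≠ m + 1 := by omega
      simp [ymat, Fin.val_rev, h0, h1]
    have htop : ymat (m+1) p e b g (Fin.last m).rev.castSucc j =
        if (j : ℕ) = m + 1 then Cc e else 0 := by
      simp [ymat]
    simp only [hmid, htop]
    by_cases hj0 : (j : ℕ) = 0
    · have h (x : Fin m) : 0 ≠ m - (x : ℕ) := by omega
      simp [ymat, hj0, h]
    by_cases hjk : (j : ℕ) = m + 1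
    · obtain rfl : j = Fin.last (m+1) := Fin.ext hjk
      have h (x : Fin m) : m + 1 ≠ m - (x : ℕ) := by omega
      simp only [ymat_last_last, Fin.val_last, h, if_true, if_false, Cc_add, Cc_sub, Cc_mul,
        Cc_sum, mul_sub, Finset.sum_sub_distrib]
      simp only [mul_comm (Cc (b _)) (Cc (v _))]
      ring
    · have hlt : m - (j : ℕ) < m := by omega
      have h (x : Fin m) : (j : ℕ) = m - (x : ℕ) ↔ x = ⟨m - j, hlt⟩ := by
        rw [Fin.ext_iff]; dsimp only; omega
      have h' : m + 1 - (j : ℕ) - 1 = m - j := by omega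
      simp [ymat, hj0, hjk, h, h', Cc_sub, Cc_neg]
      ring
  · rw [xminusK_mul_apply_of_ne _ _ hi]
    simp [ymat, hi]

/-- The parameters `p` and `g` are determined by the matrix `y(p,e,b,g)`. -/
lemma ymat_injective (m : ℕ) {p p' e : ℂ} {b g g' : Fin m → ℂ}
    (h : ymat (m+1) p e b g = ymat (m+1) p' e b g') : p = p' ∧ g = g' := by
  have hg : g = g' := by
    funext i
    have hi := congr_fun (congr_fun h (Fin.last _)) i.rev.succ.castSucc
    have h1 : m - ((i : ℕ) + 1) ≠ m := by omega
    have h2 : m - (m - ((i : ℕ) + 1)) - 1 = i := by omega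
    simp [ymat, Fin.val_rev, h1, h2] at hi
    exact neg_injective (Cc_injective hi)
  subst hg
  refine ⟨?_, rfl⟩
  have hp := congr_fun (congr_fun h (Fin.last _)) (Fin.last _)
  simp only [ymat_last_last, sub_right_inj] at hp
  simpa using Cc_injective hp

/-- Left multiplication by `x₋(v)` on matrices `y(p,e,b,g)`
translates `g` and `p` (realizing the translation action of `𝔾_a^k` on the open
Zastava coordinates), leaves `e` and `b` unchanged, and the action is free. -/
theorem statement5 (k : ℕ) (hk : 1 ≤ k) :
    ∀ (v : Fin k → ℂ) (p e : ℂ), e ≠ 0 → ∀ b g : Fin (k-1) → ℂ,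
      (xminusK k v * ymat k p e b g =
        ymat k (p - v ⟨k - 1, by omega⟩ * e) e b
          (fun i : Fin (k-1) => g i - v ⟨(i : ℕ), by have := i.isLt; omega⟩)) ∧
      (xminusK k v * ymat k p e b g = ymat k p e b g → v = 0) := by
  obtain ⟨m, rfl⟩ : ∃ m, k = m + 1 := ⟨k - 1, by omega⟩
  intro v p e he b g
  refine ⟨xminusK_mul_ymat m v p e b g, fun h => ?_⟩
  obtain ⟨hp, hg⟩ := ymat_injective m ((xminusK_mul_ymat m v p e b g).symm.trans h)
  funext i
  induction i using Fin.lastCases with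
  | last => simpa [he] using hp
  | cast i => simpa using congr_fun hg i

end
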